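/- Let l ≥ 2, let β ∈ V_1 ⊖ S_1 and γ ∈ V_l ⊖ S_l. Then for every m, n ≥ 0 there exist real numbers b_{k,j}^{m,n} (0 ≤ k ≤ m, 0 ≤ j ≤ n) and c_{k,j}^{m,n} (0 ≤ k ≤ m, 0 ≤ j ≤ n) such that h_m(h_n^r β) = Σ_{k≤m, j≤n} b_{k,j}^{m,n} β_{k,j} and h_m(h_n^r γ) = Σ_{k≤m, j≤n} c_{k,j}^{m,n} γ_{k,j} in ℓ²(W), and moreover c_{k,j}^{m,n} = b_{k,j}^{m,n} + b_{k+1,j+1}^{m,n} for all 0 ≤ k ≤ m and 0 ≤ j ≤ n, with the convention b_{k,j}^{m,n} = 0 whenever k > m or j > n. -/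

import Mathlib

noncomputable section

open scoped ComplexInnerProductSpace

namespace UCoxMasa

/-- The universal Coxeter matrix on `Fin L`: all off-diagonal entries are `0` (representing ∞). -/
def Mat (L : ℕ) : CoxeterMatrix (Fin L) where
  M := fun i j => if i = j then 1 else 0
  isSymm := by
    ext i j
    by_cases h : i = j <;> simp [Matrix.transpose, h, eq_comm]
  diagonal := fun i => by simp
  off_diagonal := fun i j h => by simp [h]

/-- The universal Coxeter group on `L` generators: free product of `L` copies of `ℤ/2ℤ`. -/
abbrev W (L : ℕ) : Type := (Mat L).Group

/-- The distinguished Coxeter system of `W L`. -/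
def cs (L : ℕ) : CoxeterSystem (Mat L) (W L) := CoxeterMatrix.toCoxeterSystem (Mat L)

/-- The simple reflection associated to `i : Fin L`. -/
def σ {L : ℕ} (i : Fin L) : W L := (cs L).simple i

/-- Word length on `W L` with respect to the generating set of simple reflections. -/
def len {L : ℕ} (w : W L) : ℕ := (cs L).length w

/-- The Hilbert space `ℓ²(W)`. -/
abbrev H (L : ℕ) : Type := lp (fun _ : W L => ℂ) 2

/-- The standard orthonormal basis vector `δ_w` of `ℓ²(W)`. -/
def δ {L : ℕ} (w : W L) : H L :=
  letI := Classical.decEq (W L)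
  lp.single 2 w 1

/-- `V l`: the linear span of `{δ_w : ℓ(w) = l}`. -/
def V (L : ℕ) (l : ℕ) : Submodule ℂ (H L) :=
  Submodule.span ℂ {x : H L | ∃ w : W L, len w = l ∧ x = δ w}

/-- `S_l`: the linear span of `q_l(h V_{l-1}) ∪ q_l(R_h V_{l-1})`,
given the projections `Q`, the operator `h` and the right operator `Rh`. -/
def Sl (L : ℕ) (Q : ℕ → (H L →L[ℂ] H L)) (h Rh : H L →L[ℂ] H L) (l : ℕ) :
    Submodule ℂ (H L) :=
  Submodule.span ℂ
    ({x : H L | ∃ y ∈ V L (l - 1), x = Q l (h y)} ∪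
      {x : H L | ∃ y ∈ V L (l - 1), x = Q l (Rh y)})

end UCoxMasa


namespace UCoxMasa

section Group

variable {L : ℕ}

/-- Words without two equal consecutive letters; these turn out to be the reduced words. -/
abbrev RWord (L : ℕ) : Type := {x : List (Fin L) // x.IsChain (· ≠ ·)}

/-- Left multiplication by a generator, on words without repetition. -/
def RWord.step (s : Fin L) : RWord L → RWord L
  | ⟨[], _⟩ => ⟨[s], List.isChain_singleton s⟩
  | ⟨a :: y, h⟩ =>
    if hs : s = a then ⟨y, h.tail⟩ else ⟨s :: a :: y, List.isChain_cons_cons.2 ⟨hs, h⟩⟩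

theorem RWord.step_step (s : Fin L) (x : RWord L) : (x.step s).step s = x := by
  obtain ⟨_ | ⟨a, y⟩, h⟩ := x
  · simp [step]
  · by_cases hs : s = a
    · subst hs
      cases y with
      | nil => simp [step]
      | cons b y =>
        have := (List.isChain_cons_cons.1 h).1
        simp [step, this]
    · simp [step, hs]

theorem RWord.wordProd_step (s : Fin L) (x : RWord L) :
    (cs L).wordProd (x.step s).1 = σ s * (cs L).wordProd x.1 := by
  obtain ⟨_ | ⟨a, y⟩, h⟩ := x
  · simp [step, σ]
  · by_cases hs : s = a
    · subst hs
      simp [step, σ, CoxeterSystem.wordProd_cons]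
    · simp [step, σ, CoxeterSystem.wordProd_cons, hs]

theorem RWord.length_step_le (s : Fin L) (x : RWord L) :
    (x.step s).1.length ≤ x.1.length + 1 := by
  obtain ⟨_ | ⟨a, y⟩, h⟩ := x
  · simp [step]
  · by_cases hs : s = a
    · simp only [step, hs, dite_true, List.length_cons]; omega
    · simp [step, hs]

/-- Left multiplication by a generator as an element of the endomorphism monoid. -/
def stepEnd (s : Fin L) : Function.End (RWord L) := RWord.step s

theorem isLiftable_stepEnd : (Mat L).IsLiftable (stepEnd (L := L)) := by
  intro i j
  by_cases h : i = j
  · subst h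
    rw [(Mat L).diagonal, pow_one]
    funext x
    exact RWord.step_step i x
  · have : (Mat L).M i j = 0 := by simp [Mat, h]
    rw [this, pow_zero]

/-- The action of `W` on words without repetition. -/
def rwordAction (L : ℕ) : W L →* Function.End (RWord L) :=
  (cs L).lift ⟨stepEnd, isLiftable_stepEnd⟩

theorem rwordAction_σ_mul (s : Fin L) (w : W L) (x : RWord L) :
    rwordAction L (σ s * w) x = (rwordAction L w x).step s := by
  rw [map_mul]
  change rwordAction L (σ s) (rwordAction L w x) = _
  rw [rwordAction, σ, CoxeterSystem.lift_apply_simple]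
  rfl

theorem length_rwordAction_le (ω : List (Fin L)) :
    (rwordAction L ((cs L).wordProd ω) ⟨[], List.isChain_nil⟩).1.length ≤ ω.length := by
  induction ω with
  | nil =>
    rw [CoxeterSystem.wordProd_nil, map_one]
    exact le_rfl
  | cons a ω ih =>
    have := rwordAction_σ_mul a ((cs L).wordProd ω) ⟨[], List.isChain_nil⟩
    rw [CoxeterSystem.wordProd_cons]
    rw [σ] at this
    rw [this]
    exact (RWord.length_step_le _ _).trans (by simpa using ih)

theorem rwordAction_wordProd {x : List (Fin L)} (hx : x.IsChain (· ≠ ·)) :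
    rwordAction L ((cs L).wordProd x) ⟨[], List.isChain_nil⟩ = ⟨x, hx⟩ := by
  induction x with
  | nil =>
    rw [CoxeterSystem.wordProd_nil, map_one]
    rfl
  | cons a x ih =>
    have := rwordAction_σ_mul a ((cs L).wordProd x) ⟨[], List.isChain_nil⟩
    rw [CoxeterSystem.wordProd_cons]
    rw [σ] at this
    rw [this, ih hx.tail]
    cases x with
    | nil => rfl
    | cons b x =>
      have := (List.isChain_cons_cons.1 hx).1
      simp [RWord.step, this]

theorem len_wordProd {x : List (Fin L)} (hx : x.IsChain (· ≠ ·)) :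
    len ((cs L).wordProd x) = x.length := by
  refine le_antisymm ((cs L).length_wordProd_le x) ?_
  obtain ⟨ω, hω, h⟩ := (cs L).exists_isReduced ((cs L).wordProd x)
  have h1 := length_rwordAction_le ω
  rw [← h, rwordAction_wordProd hx] at h1
  rw [len, h, hω.eq]
  exact h1

theorem exists_wordProd_eq (w : W L) :
    ∃ x : List (Fin L), x.IsChain (· ≠ ·) ∧ (cs L).wordProd x = w := by
  induction w using (cs L).simple_induction_left with
  | one => exact ⟨[], List.isChain_nil, (cs L).wordProd_nil⟩
  | mul_simple_left w s ih =>
    obtain ⟨x, hx, rfl⟩ := ih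
    exact ⟨_, (RWord.step s ⟨x, hx⟩).2, RWord.wordProd_step s ⟨x, hx⟩⟩

theorem σ_mul_σ_mul (s : Fin L) (w : W L) : σ s * (σ s * w) = w :=
  (cs L).simple_mul_simple_cancel_left s

theorem σ_mul_wordProd (s : Fin L) (x : List (Fin L)) :
    σ s * (cs L).wordProd x = (cs L).wordProd (s :: x) :=
  ((cs L).wordProd_cons s x).symm

theorem σ_mul_wordProd_self (s : Fin L) (x : List (Fin L)) :
    σ s * (cs L).wordProd (s :: x) = (cs L).wordProd x := by
  rw [← σ_mul_wordProd, σ_mul_σ_mul]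

theorem len_σ_mul (s : Fin L) (w : W L) : len (σ s * w) = len w + 1 ∨ len (σ s * w) + 1 = len w :=
  (cs L).length_simple_mul w s

theorem len_inv (w : W L) : len w⁻¹ = len w := (cs L).length_inv w

theorem inv_σ_mul (s : Fin L) (w : W L) : (σ s * w)⁻¹ = w⁻¹ * σ s := by
  rw [mul_inv_rev, σ, CoxeterSystem.inv_simple]

theorem len_σ_mul_lt_iff {a : Fin L} {x : List (Fin L)} (hx : (a :: x).IsChain (· ≠ ·))
    (s : Fin L) :
    len (σ s * (cs L).wordProd (a :: x)) < len ((cs L).wordProd (a :: x)) ↔ s = a := by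
  constructor
  · intro h
    by_contra hs
    rw [σ_mul_wordProd, len_wordProd hx, len_wordProd (List.isChain_cons_cons.2 ⟨hs, hx⟩)] at h
    simp at h
  · rintro rfl
    have hx' : x.IsChain (· ≠ ·) := hx.tail
    rw [σ_mul_wordProd_self, len_wordProd hx, len_wordProd hx']
    simp

theorem card_descents (w : W L) :
    (Finset.univ.filter fun s : Fin L => len (σ s * w) < len w).card =
      if len w = 0 then 0 else 1 := by
  obtain ⟨_ | ⟨a, x⟩, hx, rfl⟩ := exists_wordProd_eq w
  · simp [len]
  · simp only [len_σ_mul_lt_iff hx]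
    simp [len_wordProd hx, Finset.filter_eq']

theorem card_ascents (w : W L) :
    (Finset.univ.filter fun s : Fin L => ¬ len (σ s * w) < len w).card =
      if len w = 0 then L else L - 1 := by
  have h := Finset.card_filter_add_card_filter_not (s := (Finset.univ : Finset (Fin L)))
    (fun s : Fin L => len (σ s * w) < len w)
  rw [card_descents, Finset.card_univ, Fintype.card_fin] at h
  split_ifs at h ⊢ <;> omega

theorem finite_sphere (n : ℕ) : {w : W L | len w = n}.Finite := by
  refine ((List.finite_length_eq (Fin L) n).image (cs L).wordProd).subset ?_
  intro w hw
  obtain ⟨x, hx, rfl⟩ := exists_wordProd_eq w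
  exact ⟨x, by simpa [len_wordProd hx] using hw, rfl⟩

/-- The sphere of radius `n` in `W`. -/
def sphere (L n : ℕ) : Finset (W L) := (finite_sphere n).toFinset

@[simp] theorem mem_sphere {n : ℕ} {w : W L} : w ∈ sphere L n ↔ len w = n := by simp [sphere]

end Group

section Ring

variable {L : ℕ} {R : Type*} [Ring R]

/-- Reindexing of a sum over pairs of neighbours by the involution `(s, w) ↦ (s, σ s * w)`. -/
theorem sum_sphere_neighbours (F : W L → R) (n k : ℕ) :
    ∑ w ∈ sphere L n, ∑ s, (if len (σ s * w) = k then F (σ s * w) else 0) =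
      ∑ v ∈ sphere L k, (Finset.univ.filter fun s => len (σ s * v) = n).card • F v := by
  simp only [← Finset.sum_const, Finset.sum_filter]
  rw [Finset.sum_comm]
  conv_rhs => rw [Finset.sum_comm]
  refine Finset.sum_congr rfl fun s _ => ?_
  rw [← Finset.sum_filter, ← Finset.sum_filter]
  refine Finset.sum_bij' (fun w _ => σ s * w) (fun w _ => σ s * w) ?_ ?_ ?_ ?_ ?_ <;>
    simp +contextual [σ_mul_σ_mul]

theorem sum_mul_sum_sphere [Algebra ℂ R] {p : ℂ} (T : Fin L → R) (hT : ∀ s, T s * T s = 1 + p • T s)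
    (Tw : W L → R) (hTw : ∀ s w, len (σ s * w) < len w → Tw w = T s * Tw (σ s * w)) (n : ℕ) :
    (∑ s, T s) * ∑ w ∈ sphere L (n + 1), Tw w =
      ∑ w ∈ sphere L (n + 2), Tw w + p • ∑ w ∈ sphere L (n + 1), Tw w +
        (if n = 0 then L else L - 1) • ∑ w ∈ sphere L n, Tw w := by
  have key : ∀ w ∈ sphere L (n + 1), ∀ s, T s * Tw w =
      (if len (σ s * w) = n + 2 then Tw (σ s * w) else 0) +
      (if len (σ s * w) < len w then p • Tw w else 0) +
      (if len (σ s * w) = n then Tw (σ s * w) else 0) := by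
    intro w hw s
    rw [mem_sphere] at hw
    rcases len_σ_mul s w with h | h
    · rw [if_pos (by omega), if_neg (by omega), if_neg (by omega), hTw s (σ s * w)] <;>
        rw [σ_mul_σ_mul]
      · simp
      · omega
    · rw [if_neg (by omega), if_pos (by omega), if_pos (by omega), hTw s w (by omega),
        ← mul_assoc, hT]
      simp only [add_mul, one_mul, smul_mul_assoc]
      abel
  have hup : ∀ v ∈ sphere L (n + 2),
      (Finset.univ.filter fun s => len (σ s * v) = n + 1).card • Tw v = Tw v := by
    intro v hv
    rw [mem_sphere] at hv
    have : (Finset.univ.filter fun s => len (σ s * v) = n + 1) =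
        Finset.univ.filter fun s : Fin L => len (σ s * v) < len v := by
      ext s
      have := len_σ_mul s v
      simp; omega
    rw [this, card_descents, if_neg (by omega), one_smul]
  have hdown : ∀ v ∈ sphere L n,
      (Finset.univ.filter fun s => len (σ s * v) = n + 1).card • Tw v =
        (if n = 0 then L else L - 1) • Tw v := by
    intro v hv
    rw [mem_sphere] at hv
    have : (Finset.univ.filter fun s => len (σ s * v) = n + 1) =
        Finset.univ.filter fun s : Fin L => ¬ len (σ s * v) < len v := by
      ext s
      have := len_σ_mul s v
      simp; omega
    rw [this, card_ascents, hv]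
  have hmid : ∀ w ∈ sphere L (n + 1),
      ∑ s, (if len (σ s * w) < len w then p • Tw w else 0) = p • Tw w := by
    intro w hw
    rw [mem_sphere] at hw
    rw [← Finset.sum_filter, Finset.sum_const, card_descents, if_neg (by omega), one_smul]
  rw [Finset.sum_mul_sum, Finset.sum_comm,
    Finset.sum_congr rfl fun w hw => Finset.sum_congr rfl fun s _ => key w hw s]
  simp only [Finset.sum_add_distrib]
  rw [sum_sphere_neighbours, sum_sphere_neighbours, Finset.sum_congr rfl hup,
    Finset.sum_congr rfl hdown, Finset.sum_congr rfl hmid, Finset.smul_sum, Finset.smul_sum]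

theorem sum_sphere_zero (Tw : W L → R) : ∑ w ∈ sphere L 0, Tw w = Tw 1 := by
  have : sphere L 0 = {1} := by
    ext w
    simp [len]
  rw [this, Finset.sum_singleton]

theorem sum_sphere_one (T : Fin L → R) (Tw : W L → R) (h1 : Tw 1 = 1)
    (hTw : ∀ s w, len (σ s * w) < len w → Tw w = T s * Tw (σ s * w)) :
    ∑ w ∈ sphere L 1, Tw w = ∑ s, T s := by
  have hT (s : Fin L) : T s = Tw (σ s) := by
    have hs : σ s * σ s = (1 : W L) := by simpa using σ_mul_σ_mul s 1
    have := hTw s (σ s) (by rw [hs]; simp [σ, len])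
    rw [this, hs, h1, mul_one]
  have hinj : Function.Injective (fun s : Fin L => (σ s : W L)) := by
    intro s t hst
    have h := rwordAction_wordProd (List.isChain_singleton s)
    have h' := rwordAction_wordProd (List.isChain_singleton t)
    simp only [CoxeterSystem.wordProd_singleton] at h h'
    simp only [σ] at hst
    rw [hst, h'] at h
    simpa using h.symm
  classical
  rw [Finset.sum_congr rfl fun s _ => hT s]
  rw [← Finset.sum_image (f := Tw) (s := Finset.univ) (g := fun s : Fin L => σ s)
    fun _ _ _ _ h => hinj h]
  congr 1
  ext w
  rw [mem_sphere, len, CoxeterSystem.length_eq_one_iff]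
  simp [σ, eq_comm]

/-- The monic polynomials in `h` that are orthogonal for the semicircle-type recursion. -/
def ortho [Algebra ℂ R] (p c : ℂ) (h : R) : ℕ → R
  | 0 => 1
  | 1 => h - p • 1
  | n + 2 => h * ortho p c h (n + 1) - p • ortho p c h (n + 1) - c • ortho p c h n

/-- Coefficients of the sphere polynomials in terms of the polynomials `ortho`. -/
def sphereCoeff (p : ℝ) (m k : ℕ) : ℝ :=
  if k = m then 1 else if k + 1 = m then p else if k + 2 = m then -1 else 0

theorem sphereCoeff_eq_zero (p : ℝ) {m k : ℕ} (h : m < k) : sphereCoeff p m k = 0 := by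
  rw [sphereCoeff, if_neg (by omega), if_neg (by omega), if_neg (by omega)]

theorem sphere_add_two_eq [Algebra ℂ R] {p : ℂ} (hL : 1 ≤ L) {h : R} {hn : ℕ → R} (h0 : hn 0 = 1) (h1 : hn 1 = h)
    (hrec : ∀ n, h * hn (n + 1) =
      hn (n + 2) + p • hn (n + 1) + (if n = 0 then L else L - 1) • hn n) (n : ℕ) :
    hn (n + 2) = ortho p (L - 1) h (n + 2) + p • ortho p (L - 1) h (n + 1) -
      ortho p (L - 1) h n := by
  have hLc : ∀ x : R, (L - 1) • x = ((L : ℂ) - 1) • x := fun x => by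
    rw [← Nat.cast_smul_eq_nsmul ℂ, Nat.cast_sub hL, Nat.cast_one]
  induction n using Nat.strong_induction_on with
  | _ n ih =>
    match n with
    | 0 =>
      have := hrec 0
      rw [if_pos rfl, ← Nat.cast_smul_eq_nsmul ℂ, h0, h1, ← sub_eq_iff_eq_add,
        ← sub_eq_iff_eq_add] at this
      rw [← this]
      simp only [ortho, mul_sub, mul_smul_comm, mul_one]
      module
    | 1 =>
      have := hrec 1
      rw [if_neg one_ne_zero, hLc, ih 0 one_pos, h1, ← sub_eq_iff_eq_add,
        ← sub_eq_iff_eq_add] at this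
      rw [← this]
      simp only [ortho, mul_sub, mul_add, mul_smul_comm, mul_one]
      module
    | n + 2 =>
      have := hrec (n + 2)
      rw [if_neg (by omega), hLc, ih (n + 1) (by omega), ih n (by omega), ← sub_eq_iff_eq_add,
        ← sub_eq_iff_eq_add] at this
      rw [← this]
      simp only [ortho, mul_sub, mul_add, mul_smul_comm]
      module

theorem sphere_eq_sum_ortho [Algebra ℂ R] {p : ℝ} (hL : 1 ≤ L) {h : R} {hn : ℕ → R} (h0 : hn 0 = 1)
    (h1 : hn 1 = h) (hrec : ∀ n, h * hn (n + 1) =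
      hn (n + 2) + (p : ℂ) • hn (n + 1) + (if n = 0 then L else L - 1) • hn n) (m : ℕ) :
    hn m = ∑ k ∈ Finset.range (m + 1), (sphereCoeff p m k : ℂ) • ortho (p : ℂ) (L - 1) h k := by
  match m with
  | 0 => simp [h0, ortho, sphereCoeff]
  | 1 => simp [Finset.sum_range_succ, h1, ortho, sphereCoeff]
  | m + 2 =>
    rw [sphere_add_two_eq hL h0 h1 hrec, Finset.sum_range_succ, Finset.sum_range_succ,
      Finset.sum_range_succ, Finset.sum_eq_zero]
    · simp [sphereCoeff]
      abel
    · intro k hk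
      rw [Finset.mem_range] at hk
      rw [sphereCoeff, if_neg (by omega), if_neg (by omega), if_neg (by omega)]
      simp

end Ring

section Coordinates

variable {L : ℕ}

theorem δ_apply (u w : W L) [Decidable (w = u)] : (δ u : H L) w = if w = u then 1 else 0 := by
  classical
  rw [δ, lp.single_apply, Pi.single_apply]
  congr

/-- Evaluation at a group element as a bounded functional on `ℓ²(W)`. -/
def coord (w : W L) : H L →L[ℂ] ℂ := innerSL ℂ (δ w)

@[simp] theorem coord_apply (w : W L) (f : H L) : coord w f = f w := by
  classical
  rw [coord, innerSL_apply_apply, δ]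
  simp [lp.inner_single_left]

theorem inner_δ (f : H L) (w : W L) : ⟪f, δ w⟫ = (starRingEnd ℂ) (f w) := by
  classical
  rw [δ]
  simp [lp.inner_single_right]

theorem clm_ext_δ {E : Type*} [NormedAddCommGroup E] [NormedSpace ℂ E] {φ ψ : H L →L[ℂ] E}
    (h : ∀ w, φ (δ w) = ψ (δ w)) : φ = ψ := by
  classical
  ext f
  have hf : HasSum (fun w => f w • δ w) f := by
    have := lp.hasSum_single (E := fun _ : W L => ℂ) (p := 2) ENNReal.ofNat_ne_top f
    convert this using 2 with w
    rw [δ, ← lp.single_smul, smul_eq_mul, mul_one]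
  have h1 := hf.mapL φ
  have h2 := hf.mapL ψ
  simp only [map_smul, h] at h1 h2
  exact h1.unique h2

/-- The operators `T` are the Hecke operators in the coordinates of `W` given by `ι`. -/
def IsHecke (p : ℝ) (ι : W L ≃ W L) (T : Fin L → H L →L[ℂ] H L) : Prop :=
  ∀ (s : Fin L) (w : W L), T s (δ (ι w)) =
    if len (σ s * w) < len w then δ (ι (σ s * w)) + (p : ℂ) • δ (ι w) else δ (ι (σ s * w))

theorem isHecke_inv {p : ℝ} {Tr : Fin L → H L →L[ℂ] H L}
    (hTr : ∀ (s : Fin L) (w : W L),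
      Tr s (δ w) =
        if len (w * σ s) < len w then δ (w * σ s) + (p : ℂ) • δ w else δ (w * σ s)) :
    IsHecke p (Equiv.inv (W L)) Tr := by
  intro s w
  simp only [Equiv.inv_apply]
  rw [hTr, ← inv_σ_mul, len_inv, len_inv]

variable {p : ℝ} {ι : W L ≃ W L} {T : Fin L → H L →L[ℂ] H L}

theorem IsHecke.apply (hT : IsHecke p ι T) (s : Fin L) (f : H L) (w : W L) :
    T s f (ι w) = f (ι (σ s * w)) + if len (σ s * w) < len w then p * f (ι w) else 0 := by
  classical
  have key : (coord (ι w)).comp (T s) =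
      coord (ι (σ s * w)) + (if len (σ s * w) < len w then (p : ℂ) else 0) • coord (ι w) := by
    refine clm_ext_δ fun u => ?_
    obtain ⟨v, rfl⟩ := ι.surjective u
    have hiff : w = σ s * v ↔ σ s * w = v :=
      ⟨fun h => by rw [h, σ_mul_σ_mul], fun h => by rw [← h, σ_mul_σ_mul]⟩
    rw [ContinuousLinearMap.comp_apply, hT s v]
    by_cases hv : w = v
    · subst hv
      split_ifs <;> simp only [map_add, map_smul, add_apply, smul_apply, coord_apply] <;>
        simp [δ_apply, hiff]
    · split_ifs <;> simp only [map_add, map_smul, add_apply, smul_apply, coord_apply] <;>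
        simp [δ_apply, hiff, hv]
  have := congrArg (fun φ : H L →L[ℂ] ℂ => φ f) key
  simpa only [ContinuousLinearMap.comp_apply, add_apply, smul_apply, coord_apply, smul_eq_mul,
    ite_mul, zero_mul] using this

theorem IsHecke.mul_self (hT : IsHecke p ι T) (s : Fin L) : T s * T s = 1 + (p : ℂ) • T s := by
  ext f u
  obtain ⟨w, rfl⟩ := ι.surjective u
  have h1 := hT.apply s (T s f) w
  have h2 := hT.apply s f (σ s * w)
  have h3 := hT.apply s f w
  rw [σ_mul_σ_mul] at h2
  change (T s (T s f)) (ι w) = f (ι w) + p * (T s f) (ι w)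
  rw [h1, h2, h3]
  rcases len_σ_mul s w with h | h
  · simp only [show len w < len (σ s * w) by omega, show ¬ len (σ s * w) < len w by omega,
      if_true, if_false]
    ring
  · simp only [show ¬ len w < len (σ s * w) by omega, show len (σ s * w) < len w by omega,
      if_true, if_false]
    ring

theorem tsum_sphere (F : W L → H L →L[ℂ] H L) (n : ℕ) :
    ∑' w : {w : W L // len w = n}, F w = ∑ w ∈ sphere L n, F w := by
  rw [← Finset.tsum_subtype]
  exact tsum_congr_set_coe F (by ext; exact mem_sphere.symm)

theorem sum_sphere_inv (F : W L → H L →L[ℂ] H L) (n : ℕ) :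
    ∑ w ∈ sphere L n, F w⁻¹ = ∑ w ∈ sphere L n, F w :=
  Finset.sum_equiv (Equiv.inv (W L)) (by simp [len_inv]) (by simp)

theorem IsHecke.sphere_eq_sum_ortho (hT : IsHecke p ι T) (hL : 1 ≤ L)
    {Tw : W L → H L →L[ℂ] H L} (h1 : Tw 1 = 1)
    (hTw : ∀ s w, len (σ s * w) < len w → Tw w = T s * Tw (σ s * w)) (m : ℕ) :
    ∑ w ∈ sphere L m, Tw w =
      ∑ k ∈ Finset.range (m + 1), (sphereCoeff p m k : ℂ) • ortho (p : ℂ) (L - 1) (∑ s, T s) k :=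
  UCoxMasa.sphere_eq_sum_ortho (hn := fun m => ∑ w ∈ sphere L m, Tw w) hL
    (by rw [sum_sphere_zero, h1]) (sum_sphere_one T Tw h1 hTw)
    (sum_mul_sum_sphere T hT.mul_self Tw hTw) m

end Coordinates

section Words

variable {L : ℕ}

/-- The functions `F` on `W` and `g` on words agree along reduced words. -/
def Rep (F : W L → ℂ) (g : List (Fin L) → ℂ) : Prop :=
  ∀ x : List (Fin L), x.IsChain (· ≠ ·) → F ((cs L).wordProd x) = g x

/-- The operator `h` acting on functions on reduced words. -/
def wordOp (p : ℂ) (g : List (Fin L) → ℂ) : List (Fin L) → ℂ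
  | [] => ∑ s, g [s]
  | a :: y => g y + (∑ s, if s = a then 0 else g (s :: a :: y)) + p * g (a :: y)

theorem IsHecke.rep_sum {p : ℝ} {ι : W L ≃ W L} {T : Fin L → H L →L[ℂ] H L}
    (hT : IsHecke p ι T) {f : H L} {g : List (Fin L) → ℂ} (hf : Rep (fun w => f (ι w)) g) :
    Rep (fun w => (∑ s, T s) f (ι w)) (wordOp p g) := by
  intro x hx
  have hsum : (∑ s, T s) f (ι ((cs L).wordProd x)) = ∑ s, T s f (ι ((cs L).wordProd x)) := by
    simp only [← coord_apply, sum_apply, map_sum]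
  beta_reduce
  rw [hsum]
  simp only [hT.apply]
  cases x with
  | nil =>
    refine Finset.sum_congr rfl fun s _ => ?_
    have : len (1 : W L) = 0 := (cs L).length_one
    rw [if_neg (by simp [this]), σ_mul_wordProd, add_zero]
    exact hf _ (List.isChain_singleton s)
  | cons a y =>
    have key (s : Fin L) : f (ι (σ s * (cs L).wordProd (a :: y))) =
        (if s = a then g y else 0) + if s = a then 0 else g (s :: a :: y) := by
      split_ifs with hs
      · subst hs
        rw [σ_mul_wordProd_self, add_zero]
        exact hf _ hx.tail
      · rw [σ_mul_wordProd, zero_add]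
        exact hf _ (List.isChain_cons_cons.2 ⟨hs, hx⟩)
    have hfx : f (ι ((cs L).wordProd (a :: y))) = g (a :: y) := hf _ hx
    simp only [key, hfx, len_σ_mul_lt_iff hx, Finset.sum_add_distrib, wordOp]
    simp

/-- The three-term recursion satisfied by the orthogonal polynomials of `h` applied to a vector. -/
def IsRecursive (p : ℝ) (g : ℕ → List (Fin L) → ℂ) : Prop :=
  (∀ x, x.IsChain (· ≠ ·) → wordOp p (g 0) x = g 1 x + p * g 0 x) ∧
    ∀ k x, x.IsChain (· ≠ ·) →
      wordOp p (g (k + 1)) x = g (k + 2) x + p * g (k + 1) x + (L - 1) * g k x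

theorem IsHecke.rep_ortho {p : ℝ} {ι : W L ≃ W L} {T : Fin L → H L →L[ℂ] H L}
    (hT : IsHecke p ι T) {f : H L} {g : ℕ → List (Fin L) → ℂ} (hf : Rep (fun w => f (ι w)) (g 0))
    (hg : IsRecursive p g) (k : ℕ) :
    Rep (fun w => ortho (p : ℂ) (L - 1) (∑ s, T s) k f (ι w)) (g k) := by
  induction k using Nat.strong_induction_on with
  | _ k ih =>
    match k with
    | 0 => exact hf
    | 1 =>
      intro x hx
      have h1 := hT.rep_sum hf x hx
      have h0 := hf x hx
      rw [hg.1 x hx] at h1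
      simp only at h0 h1
      change ((∑ s, T s) f) (ι _) - p * f (ι _) = _
      rw [h1, h0]
      ring
    | k + 2 =>
      intro x hx
      have h1 := ih (k + 1) (by omega) x hx
      have h0 := ih k (by omega) x hx
      have h2 := hT.rep_sum (ih (k + 1) (by omega)) x hx
      rw [hg.2 k x hx] at h2
      simp only at h0 h1 h2
      change (((∑ s, T s) (ortho (p : ℂ) (L - 1) (∑ s, T s) (k + 1) f)) (ι _)) -
        p * (ortho (p : ℂ) (L - 1) (∑ s, T s) (k + 1) f) (ι _) -
        (L - 1) * (ortho (p : ℂ) (L - 1) (∑ s, T s) k f) (ι _) = _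
      rw [h2, h1, h0]
      ring

theorem isChain_ne_reverse {x : List (Fin L)} (hx : x.IsChain (· ≠ ·)) :
    x.reverse.IsChain (· ≠ ·) := by
  rw [List.isChain_reverse]
  exact hx.imp fun _ _ h => h.symm

theorem Rep.inv {F : W L → ℂ} {g : List (Fin L) → ℂ} (h : Rep F g) :
    Rep (fun w => F w⁻¹) (fun x => g x.reverse) := by
  intro x hx
  beta_reduce
  rw [← CoxeterSystem.wordProd_reverse]
  exact h _ (isChain_ne_reverse hx)

theorem Rep.ext {f f' : H L} {g : List (Fin L) → ℂ} (h : Rep f g) (h' : Rep f' g) : f = f' := by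
  ext w
  obtain ⟨x, hx, rfl⟩ := exists_wordProd_eq w
  rw [h x hx, h' x hx]

/-- The vectors obtained from applying orthogonal polynomials of the left and right operators. -/
theorem rep_ortho_ortho {p : ℝ} {T Tr : Fin L → H L →L[ℂ] H L}
    (hT : IsHecke p (Equiv.refl _) T) (hTr : IsHecke p (Equiv.inv _) Tr) {f : H L}
    {g g' : ℕ → ℕ → List (Fin L) → ℂ} (hrev : ∀ k j x, g k j x.reverse = g' j k x)
    (hg : ∀ j, IsRecursive p fun k => g k j) (hg' : ∀ k, IsRecursive p fun j => g' j k)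
    (hf : Rep f (g 0 0)) (k j : ℕ) :
    Rep (ortho (p : ℂ) (L - 1) (∑ s, T s) k (ortho (p : ℂ) (L - 1) (∑ s, Tr s) j f)) (g k j) := by
  refine hT.rep_ortho (g := fun k => g k j) ?_ (hg j) k
  have h0 : Rep (fun w => f (Equiv.inv (W L) w)) (g' 0 0) := by
    have := hf.inv
    simp only [hrev] at this
    exact this
  have h1 := (hTr.rep_ortho (g := fun j => g' j 0) h0 (hg' 0) j).inv
  simp only [← hrev, List.reverse_reverse] at h1
  simpa using h1

/-- The function on words of length `k + j + l` that reads off `X` on the middle part. -/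
def middle (X : List (Fin L) → ℂ) (l k j : ℕ) (x : List (Fin L)) : ℂ :=
  if x.length = k + j + l then X ((x.drop k).take l) else 0

theorem middle_reverse (X : List (Fin L) → ℂ) (l k j : ℕ) (x : List (Fin L)) :
    middle X l k j x.reverse = middle (fun y => X y.reverse) l j k x := by
  simp only [middle, List.length_reverse]
  rw [Nat.add_comm k j]
  split_ifs with h
  · congr 1
    rw [List.drop_reverse, List.take_reverse, List.drop_take, List.length_take]
    rw [show min (x.length - k) x.length - l = j by omega,
      show x.length - k - j = l by omega]
  · rfl

theorem wordOp_middle_succ {X : List (Fin L) → ℂ} {l : ℕ} (hl : 1 ≤ l) (p : ℂ) (k j : ℕ)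
    (x : List (Fin L)) :
    wordOp p (middle X l (k + 1) j) x =
      middle X l (k + 2) j x + p * middle X l (k + 1) j x + (L - 1) * middle X l k j x := by
  cases x with
  | nil =>
    have h1 : ¬ 0 + 1 = k + 1 + j + l := by omega
    have h2 (i : ℕ) : ¬ 0 = i + j + l := by omega
    simp only [wordOp, middle, List.length_cons, List.length_nil, if_neg h1, if_neg (h2 _)]
    simp
  | cons a y =>
    have h1 : middle X l (k + 1) j y = middle X l (k + 2) j (a :: y) := by
      simp only [middle, List.length_cons, List.drop_succ_cons]
      refine if_congr (by omega) rfl rfl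
    have h2 (s : Fin L) : middle X l (k + 1) j (s :: a :: y) = middle X l k j (a :: y) := by
      simp only [middle, List.length_cons, List.drop_succ_cons]
      refine if_congr (by omega) rfl rfl
    have h3 (c : ℂ) : (∑ s : Fin L, if s = a then 0 else c) = (L - 1) * c := by
      have (s : Fin L) : (if s = a then 0 else c) = c - if s = a then c else 0 := by
        split_ifs <;> simp
      simp only [this, Finset.sum_sub_distrib]
      simp [sub_mul]
    simp only [wordOp, h1, h2, h3]
    ring

theorem wordOp_middle_zero {X : List (Fin L) → ℂ} {l : ℕ} (hl : 2 ≤ l)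
    (hX : ∀ (a : Fin L) (y : List (Fin L)), (a :: y).IsChain (· ≠ ·) → (a :: y).length + 1 = l →
      (∑ s, if s = a then 0 else X (s :: a :: y)) = 0) (p : ℂ) (j : ℕ)
    {x : List (Fin L)} (hx : x.IsChain (· ≠ ·)) :
    wordOp p (middle X l 0 j) x = middle X l 1 j x + p * middle X l 0 j x := by
  cases x with
  | nil =>
    have h1 : ¬ 1 = j + l := by omega
    have h2 : ¬ 0 = j + l := by omega
    have h3 : ¬ 0 = 1 + j + l := by omega
    simp [wordOp, middle, h1, h2, h3]
  | cons a y =>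
    obtain ⟨l, rfl⟩ : ∃ k, l = k + 2 := ⟨l - 2, by omega⟩
    have h1 : middle X (l + 2) 0 j y = middle X (l + 2) 1 j (a :: y) := by
      simp only [middle, List.length_cons, List.drop_succ_cons]
      exact if_congr (by omega) rfl rfl
    have h2 : (∑ s : Fin L, if s = a then 0 else middle X (l + 2) 0 j (s :: a :: y)) = 0 := by
      by_cases h : (a :: y).length + 1 = j + (l + 2)
      · have hlen : (a :: y.take l).length + 1 = l + 2 := by
          simp only [List.length_cons, List.length_take] at h ⊢
          omega
        have hch : (a :: y.take l).IsChain (· ≠ ·) := by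
          simpa using hx.take (l + 1)
        refine (Finset.sum_congr rfl fun s _ => ?_).trans (hX a _ hch hlen)
        simp only [List.length_cons] at h
        simp [middle, h]
      · refine Finset.sum_eq_zero fun s _ => ?_
        have hs : middle X (l + 2) 0 j (s :: a :: y) = 0 := by
          rw [middle, if_neg]
          simpa using h
        rw [hs, ite_self]
    simp only [wordOp, h1, h2]
    ring

theorem isRecursive_middle {p : ℝ} {X : List (Fin L) → ℂ} {l : ℕ} (hl : 2 ≤ l)
    (hX : ∀ (a : Fin L) (y : List (Fin L)), (a :: y).IsChain (· ≠ ·) → (a :: y).length + 1 = l →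
      (∑ s, if s = a then 0 else X (s :: a :: y)) = 0) (j : ℕ) :
    IsRecursive p fun k => middle X l k j :=
  ⟨fun _ hx => wordOp_middle_zero hl hX p j hx,
    fun k x _ => wordOp_middle_succ (by omega) p k j x⟩

theorem wordOp_middle_one_zero {X : List (Fin L) → ℂ} (hX : ∑ s, X [s] = 0) (p : ℂ) (j : ℕ)
    (x : List (Fin L)) :
    wordOp p (middle X 1 0 j) x = middle X 1 1 j x + p * middle X 1 0 j x -
      if j = 0 then 0 else middle X 1 0 (j - 1) x := by
  cases x with
  | nil =>
    by_cases hj : j = 0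
    · subst hj
      simp [wordOp, middle, hX]
    · have h1 : ¬ 1 = j + 1 := by omega
      have h2 : ¬ 0 = 1 + j + 1 := by omega
      simp [wordOp, middle, hj]
  | cons a y =>
    have h1 : middle X 1 0 j y = middle X 1 1 j (a :: y) := by
      simp only [middle, List.length_cons, List.drop_succ_cons]
      exact if_congr (by omega) rfl rfl
    have h2 : (∑ s : Fin L, if s = a then 0 else middle X 1 0 j (s :: a :: y)) =
        - if j = 0 then 0 else middle X 1 0 (j - 1) (a :: y) := by
      by_cases h : (a :: y).length = j
      · have hj : j ≠ 0 := by rintro rfl; simp at h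
        have hc : y.length + 1 = j := by simpa using h
        have hc' : (a :: y).length = 0 + (j - 1) + 1 := by omega
        rw [if_neg hj, middle, if_pos hc']
        have (s : Fin L) : (if s = a then 0 else middle X 1 0 j (s :: a :: y)) =
            X [s] - if s = a then X [a] else 0 := by
          split_ifs with hs
          · simp [hs]
          · simp [middle, hc]
        simp only [this, Finset.sum_sub_distrib, hX]
        simp
      · have h' : ¬ (a :: y).length = 0 + (j - 1) + 1 ∨ j = 0 := by omega
        rw [Finset.sum_eq_zero]
        · rcases h' with h' | h'
          · rw [middle, if_neg h']
            simp
          · simp [h']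
        · intro s _
          have hs : middle X 1 0 j (s :: a :: y) = 0 := by
            rw [middle, if_neg]
            simpa using h
          rw [hs, ite_self]
    simp only [wordOp, h1, h2]
    ring

/-- Alternating diagonal sums of `middle X 1`. -/
def altMiddle (X : List (Fin L) → ℂ) : ℕ → ℕ → List (Fin L) → ℂ
  | 0, j => middle X 1 0 j
  | k + 1, 0 => middle X 1 (k + 1) 0
  | k + 1, j + 1 => fun x => middle X 1 (k + 1) (j + 1) x - altMiddle X k j x

theorem altMiddle_zero_right (X : List (Fin L) → ℂ) (k : ℕ) :
    altMiddle X k 0 = middle X 1 k 0 := by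
  cases k <;> rfl

theorem altMiddle_reverse (X : List (Fin L) → ℂ) (k j : ℕ) (x : List (Fin L)) :
    altMiddle X k j x.reverse = altMiddle (fun y => X y.reverse) j k x := by
  induction k generalizing j with
  | zero => rw [altMiddle_zero_right, altMiddle, middle_reverse]
  | succ k ih =>
    cases j with
    | zero => rw [altMiddle_zero_right, altMiddle, middle_reverse]
    | succ j => simp only [altMiddle, middle_reverse, ih]

theorem altMiddle_eq_zero (X : List (Fin L) → ℂ) {k j : ℕ} {x : List (Fin L)}
    (h : k + j + 1 < x.length) : altMiddle X k j x = 0 := by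
  induction k generalizing j with
  | zero => rw [altMiddle, middle, if_neg (by omega)]
  | succ k ih =>
    cases j with
    | zero => rw [altMiddle, middle, if_neg (by omega)]
    | succ j => simp only [altMiddle]; rw [middle, if_neg (by omega), ih (by omega), sub_zero]

theorem altMiddle_eq_middle (X : List (Fin L) → ℂ) {k j : ℕ} {x : List (Fin L)}
    (h : x.length = k + j + 1) : altMiddle X k j x = middle X 1 k j x := by
  cases k with
  | zero => rfl
  | succ k =>
    cases j with
    | zero => rfl
    | succ j => simp only [altMiddle]; rw [altMiddle_eq_zero X (by omega), sub_zero]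

theorem wordOp_sub (p : ℂ) (g g' : List (Fin L) → ℂ) (x : List (Fin L)) :
    wordOp p (fun y => g y - g' y) x = wordOp p g x - wordOp p g' x := by
  cases x with
  | nil => simp [wordOp]
  | cons a y =>
    have (s : Fin L) : (if s = a then 0 else g (s :: a :: y) - g' (s :: a :: y)) =
        (if s = a then 0 else g (s :: a :: y)) - if s = a then 0 else g' (s :: a :: y) := by
      split_ifs <;> simp
    simp only [wordOp, this, Finset.sum_sub_distrib]
    ring

theorem isRecursive_altMiddle {p : ℝ} {X : List (Fin L) → ℂ} (hX : ∑ s, X [s] = 0) (j : ℕ) :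
    IsRecursive p fun k => altMiddle X k j := by
  have h0 : ∀ j x, wordOp p (altMiddle X 0 j) x = altMiddle X 1 j x + p * altMiddle X 0 j x := by
    intro j x
    rw [altMiddle, wordOp_middle_one_zero hX]
    cases j with
    | zero => simp [altMiddle]
    | succ j => simp only [altMiddle]; simp; ring
  refine ⟨fun x _ => h0 j x, fun k x _ => ?_⟩
  beta_reduce
  induction k generalizing j with
  | zero =>
    cases j with
    | zero => exact wordOp_middle_succ le_rfl p 0 0 x
    | succ j =>
      change wordOp p (fun x => middle X 1 1 (j + 1) x - altMiddle X 0 j x) x = _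
      rw [wordOp_sub, wordOp_middle_succ le_rfl, h0]
      simp only [altMiddle]
      ring
  | succ k ih =>
    cases j with
    | zero => exact wordOp_middle_succ le_rfl p (k + 1) 0 x
    | succ j =>
      rw [altMiddle, wordOp_sub, wordOp_middle_succ le_rfl, ih]
      simp only [altMiddle]
      ring

end Words

section Expansion

variable {L : ℕ}

theorem apply_eq_zero_of_mem_V {l : ℕ} {f : H L} (hf : f ∈ V L l) {w : W L} (hw : len w ≠ l) :
    f w = 0 := by
  classical
  have : V L l ≤ LinearMap.ker (coord w).toLinearMap := by
    rw [V, Submodule.span_le]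
    rintro _ ⟨u, hu, rfl⟩
    have hwu : w ≠ u := by rintro rfl; exact hw hu
    simp [δ_apply, hwu]
  simpa using this hf

theorem δ_mem_V (w : W L) : δ w ∈ V L (len w) := Submodule.subset_span ⟨w, rfl, rfl⟩

theorem projection_apply {Q : ℕ → H L →L[ℂ] H L}
    (hQ : ∀ (l : ℕ) (w : W L), Q l (δ w) = if len w = l then δ w else 0) (l : ℕ) (f : H L)
    (w : W L) : Q l f w = if len w = l then f w else 0 := by
  classical
  have key : (coord w).comp (Q l) = (if len w = l then (1 : ℂ) else 0) • coord w := by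
    refine clm_ext_δ fun u => ?_
    rw [ContinuousLinearMap.comp_apply, hQ, smul_apply, coord_apply, coord_apply, δ_apply]
    by_cases hu : w = u
    · subst hu
      by_cases hw : len w = l <;> simp [δ_apply, hw]
    · split_ifs <;> simp [δ_apply, hu]
  have := congrArg (fun φ : H L →L[ℂ] ℂ => φ f) key
  simpa only [ContinuousLinearMap.comp_apply, smul_apply, coord_apply, smul_eq_mul, ite_mul,
    one_mul, zero_mul] using this

theorem IsHecke.sum_ascents_eq_zero {p : ℝ} {ι : W L ≃ W L} {T : Fin L → H L →L[ℂ] H L}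
    (hT : IsHecke p ι T) (hι : ∀ w, len (ι w) = len w) {Q : ℕ → H L →L[ℂ] H L}
    (hQ : ∀ (l : ℕ) (w : W L), Q l (δ w) = if len w = l then δ w else 0) {l : ℕ} {f : H L}
    (hf : ∀ y ∈ V L (l - 1), ⟪f, Q l ((∑ s, T s) y)⟫ = 0) {w : W L} (hw : len w + 1 = l) :
    (∑ s, if len (σ s * w) < len w then 0 else f (ι (σ s * w))) = 0 := by
  have h := hf (δ (ι w)) (by rw [← hw, Nat.add_sub_cancel, ← hι w]; exact δ_mem_V _)
  have key (s : Fin L) : Q l (T s (δ (ι w))) =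
      if len (σ s * w) < len w then 0 else δ (ι (σ s * w)) := by
    have := len_σ_mul s w
    rw [hT s w]
    split_ifs with hs
    · rw [map_add, map_smul, hQ, hQ, hι, hι, if_neg (by omega), if_neg (by omega), smul_zero,
        add_zero]
    · rw [hQ, hι, if_pos (by omega)]
  have hsum : Q l ((∑ s, T s) (δ (ι w))) =
      ∑ s, if len (σ s * w) < len w then 0 else δ (ι (σ s * w)) := by
    rw [sum_apply, map_sum]
    exact Finset.sum_congr rfl fun s _ => key s
  rw [hsum, inner_sum] at h
  have h' := congrArg (starRingEnd ℂ) h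
  rw [map_sum, map_zero] at h'
  refine (Finset.sum_congr rfl fun s _ => ?_).trans h'
  split_ifs
  · simp
  · rw [inner_δ, Complex.conj_conj]

theorem IsHecke.sum_cons_eq_zero {p : ℝ} {ι : W L ≃ W L} {T : Fin L → H L →L[ℂ] H L}
    (hT : IsHecke p ι T) (hι : ∀ w, len (ι w) = len w) {Q : ℕ → H L →L[ℂ] H L}
    (hQ : ∀ (l : ℕ) (w : W L), Q l (δ w) = if len w = l then δ w else 0) {l : ℕ} {f : H L}
    (hf : ∀ y ∈ V L (l - 1), ⟪f, Q l ((∑ s, T s) y)⟫ = 0) (a : Fin L) (y : List (Fin L))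
    (hy : (a :: y).IsChain (· ≠ ·)) (hl : (a :: y).length + 1 = l) :
    (∑ s, if s = a then 0 else f (ι ((cs L).wordProd (s :: a :: y)))) = 0 := by
  have h := hT.sum_ascents_eq_zero hι hQ hf (w := (cs L).wordProd (a :: y))
    (by rw [len_wordProd hy, hl])
  simp only [len_σ_mul_lt_iff hy] at h
  simpa only [σ_mul_wordProd] using h

theorem IsHecke.sum_singleton_eq_zero {p : ℝ} {ι : W L ≃ W L} {T : Fin L → H L →L[ℂ] H L}
    (hT : IsHecke p ι T) (hι : ∀ w, len (ι w) = len w) {Q : ℕ → H L →L[ℂ] H L}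
    (hQ : ∀ (l : ℕ) (w : W L), Q l (δ w) = if len w = l then δ w else 0) {f : H L}
    (hf : ∀ y ∈ V L (1 - 1), ⟪f, Q 1 ((∑ s, T s) y)⟫ = 0) :
    ∑ s, f (ι ((cs L).wordProd [s])) = 0 := by
  have h1 : len (1 : W L) = 0 := (cs L).length_one
  have h := hT.sum_ascents_eq_zero hι hQ hf (w := 1) (by rw [h1])
  simpa [h1, σ] using h

theorem rep_middle {l : ℕ} {f : H L} (hf : f ∈ V L l) :
    Rep f (middle (fun x => f ((cs L).wordProd x)) l 0 0) := by
  intro x hx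
  rw [middle]
  split_ifs with h
  · rw [List.drop_zero, List.take_of_length_le (by omega)]
  · exact apply_eq_zero_of_mem_V hf (by rw [len_wordProd hx]; omega)

/-- If the top-degree part of `v k j` is `e k j`, then so is that of the sphere sums. -/
theorem rep_projection {p : ℝ} {Q : ℕ → H L →L[ℂ] H L}
    (hQ : ∀ (l : ℕ) (w : W L), Q l (δ w) = if len w = l then δ w else 0) {l : ℕ}
    {v : ℕ → ℕ → H L} {g e : ℕ → ℕ → List (Fin L) → ℂ} (hv : ∀ k j, Rep (v k j) (g k j))
    (hg : ∀ k j x, k + j + l < x.length → g k j x = 0)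
    (hge : ∀ k j x, x.length = k + j + l → g k j x = e k j x)
    (he : ∀ k j x, x.length ≠ k + j + l → e k j x = 0) (m n : ℕ) :
    Rep (Q (m + n + l) (∑ k ∈ Finset.range (m + 1), ∑ j ∈ Finset.range (n + 1),
      ((sphereCoeff p m k * sphereCoeff p n j : ℝ) : ℂ) • v k j)) (e m n) := by
  intro x hx
  rw [projection_apply hQ, len_wordProd hx]
  split_ifs with hlen
  · have hsum : ∀ k ∈ Finset.range (m + 1), ∀ j ∈ Finset.range (n + 1), ¬ (k = m ∧ j = n) →
        v k j ((cs L).wordProd x) = 0 := by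
      intro k hk j hj hkj
      rw [Finset.mem_range] at hk hj
      rw [hv k j x hx, hg k j x (by omega)]
    rw [← coord_apply, map_sum, Finset.sum_eq_single m, map_sum, Finset.sum_eq_single n]
    · rw [map_smul, coord_apply, hv m n x hx, hge m n x hlen]
      simp [sphereCoeff]
    · intro j hj hjn
      rw [map_smul, coord_apply, hsum m (by simp) j hj (by tauto), smul_zero]
    · simp
    · intro k hk hkm
      rw [map_sum]
      refine Finset.sum_eq_zero fun j hj => ?_
      rw [map_smul, coord_apply, hsum k hk j hj (by tauto), smul_zero]
    · simp
  · exact (he m n x hlen).symm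

/-- The alternating diagonal sums inverting `b ↦ (k, j) ↦ b k j + b (k + 1) (j + 1)`. -/
def altCoeff (c : ℕ → ℕ → ℝ) (m k j : ℕ) : ℝ :=
  ∑ i ∈ Finset.range (m + 1), (-1) ^ i * c (k + i) (j + i)

theorem altCoeff_add_succ {c : ℕ → ℕ → ℝ} {m n : ℕ} (hc : ∀ k j, m < k ∨ n < j → c k j = 0)
    (k j : ℕ) : altCoeff c m k j + altCoeff c m (k + 1) (j + 1) = c k j := by
  rw [altCoeff, altCoeff, Finset.sum_range_succ', Finset.sum_range_succ,
    hc (k + 1 + m) (j + 1 + m) (by omega), pow_zero, one_mul, add_zero, add_zero, mul_zero,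
    add_zero, add_right_comm, ← Finset.sum_add_distrib, Finset.sum_eq_zero, zero_add]
  intro i _
  rw [show k + (i + 1) = k + 1 + i by omega, show j + (i + 1) = j + 1 + i by omega]
  ring

theorem altCoeff_eq_zero {c : ℕ → ℕ → ℝ} {m n : ℕ} (hc : ∀ k j, m < k ∨ n < j → c k j = 0)
    {k j : ℕ} (h : m < k ∨ n < j) : altCoeff c m k j = 0 :=
  Finset.sum_eq_zero fun i _ => by rw [hc _ _ (by omega), mul_zero]

/-- Summation by parts along the diagonals. -/
theorem sum_diagonal {M : Type*} [AddCommGroup M] [Module ℂ M] {b c : ℕ → ℕ → ℝ} {m n : ℕ}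
    (hb : ∀ k j, m < k ∨ n < j → b k j = 0) (hc : ∀ k j, c k j = b k j + b (k + 1) (j + 1))
    {v E : ℕ → ℕ → M} (h0 : ∀ j, E 0 j = v 0 j) (h0' : ∀ k, E k 0 = v k 0)
    (hE : ∀ k j, E (k + 1) (j + 1) = v (k + 1) (j + 1) + v k j) :
    ∑ k ∈ Finset.range (m + 1), ∑ j ∈ Finset.range (n + 1), (c k j : ℂ) • v k j =
      ∑ k ∈ Finset.range (m + 1), ∑ j ∈ Finset.range (n + 1), (b k j : ℂ) • E k j := by
  have h1 : ∑ k ∈ Finset.range (m + 1), ∑ j ∈ Finset.range (n + 1),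
      (b (k + 1) (j + 1) : ℂ) • v k j =
      ∑ k ∈ Finset.range m, ∑ j ∈ Finset.range n, (b (k + 1) (j + 1) : ℂ) • v k j := by
    rw [Finset.sum_range_succ]
    simp [Finset.sum_range_succ, hb (m + 1) _ (Or.inl (Nat.lt_succ_self m)),
      hb _ (n + 1) (Or.inr (Nat.lt_succ_self n))]
  have h2 : ∑ k ∈ Finset.range (m + 1), ∑ j ∈ Finset.range (n + 1), (b k j : ℂ) • E k j =
      ∑ k ∈ Finset.range (m + 1), ∑ j ∈ Finset.range (n + 1), (b k j : ℂ) • v k j +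
      ∑ k ∈ Finset.range m, ∑ j ∈ Finset.range n, (b (k + 1) (j + 1) : ℂ) • v k j := by
    simp only [Finset.sum_range_succ', h0, h0', hE, smul_add, Finset.sum_add_distrib]
    abel
  rw [h2, ← h1]
  simp only [hc, Complex.ofReal_add, add_smul, Finset.sum_add_distrib]

end Expansion

theorem statement14
    (L : ℕ) (hL : 3 ≤ L) (q p : ℝ) (hq : 0 < q) (hq1 : q ≤ 1)
    (hp : p = (q - 1) / Real.sqrt q)
    (T : Fin L → H L →L[ℂ] H L)
    (hT : ∀ (s : Fin L) (w : W L),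
      T s (δ w) =
        if len (σ s * w) < len w then δ (σ s * w) + (p : ℂ) • δ w else δ (σ s * w))
    (h : H L →L[ℂ] H L) (hh : h = ∑ s, T s)
    (Tw : W L → H L →L[ℂ] H L) (hTw1 : Tw 1 = 1)
    (hTwrec : ∀ (s : Fin L) (w : W L), len (σ s * w) < len w →
      Tw w = T s ∘L Tw (σ s * w))
    (hn : ℕ → H L →L[ℂ] H L)
    (hhn : ∀ n : ℕ, hn n = ∑' w : {w : W L // len w = n}, Tw (w : W L))
    (Tr : Fin L → H L →L[ℂ] H L)
    (hTr : ∀ (s : Fin L) (w : W L),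
      Tr s (δ w) =
        if len (w * σ s) < len w then δ (w * σ s) + (p : ℂ) • δ w else δ (w * σ s))
    (Rh : H L →L[ℂ] H L) (hRh : Rh = ∑ s, Tr s)
    (Twr : W L → H L →L[ℂ] H L) (hTwr1 : Twr 1 = 1)
    (hTwrrec : ∀ (s : Fin L) (w : W L), len (w * σ s) < len w →
      Twr w = Tr s ∘L Twr (w * σ s))
    (hnr : ℕ → H L →L[ℂ] H L)
    (hhnr : ∀ n : ℕ, hnr n = ∑' w : {w : W L // len w = n}, Twr (w : W L))
    (Q : ℕ → H L →L[ℂ] H L)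
    (hQ : ∀ (l : ℕ) (w : W L), Q l (δ w) = if len w = l then δ w else 0)
    (l : ℕ) (hl : 2 ≤ l)
    (β : H L)
    (hβmem : β ∈ V L 1)
    (hβperp : ∀ y ∈ Sl L Q h Rh 1, ⟪β, y⟫ = 0)
    (γ : H L)
    (hγmem : γ ∈ V L l)
    (hγperp : ∀ y ∈ Sl L Q h Rh l, ⟪γ, y⟫ = 0)
    (m n : ℕ) :
    ∃ b c : ℕ → ℕ → ℝ,
      (∀ k j : ℕ, (m < k ∨ n < j) → b k j = 0) ∧
      (∀ k j : ℕ, (m < k ∨ n < j) → c k j = 0) ∧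
      hn m (hnr n β) =
        ∑ k ∈ Finset.range (m + 1), ∑ j ∈ Finset.range (n + 1),
          (b k j : ℂ) • Q (k + j + 1) (hn k (hnr j β)) ∧
      hn m (hnr n γ) =
        ∑ k ∈ Finset.range (m + 1), ∑ j ∈ Finset.range (n + 1),
          (c k j : ℂ) • Q (k + j + l) (hn k (hnr j γ)) ∧
      ∀ k ≤ m, ∀ j ≤ n, c k j = b k j + b (k + 1) (j + 1) := by
  have hL1 : 1 ≤ L := by omega
  have hTl : IsHecke p (Equiv.refl _) T := hT
  have hTrr : IsHecke p (Equiv.inv _) Tr := isHecke_inv hTr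
  subst hh hRh
  have expand (m : ℕ) : hn m = ∑ k ∈ Finset.range (m + 1),
      (sphereCoeff p m k : ℂ) • ortho (p : ℂ) (L - 1) (∑ s, T s) k := by
    rw [hhn, tsum_sphere]
    exact hTl.sphere_eq_sum_ortho hL1 hTw1 hTwrec m
  have expand_right (n : ℕ) : hnr n = ∑ j ∈ Finset.range (n + 1),
      (sphereCoeff p n j : ℂ) • ortho (p : ℂ) (L - 1) (∑ s, Tr s) j := by
    rw [hhnr, tsum_sphere, ← sum_sphere_inv]
    refine hTrr.sphere_eq_sum_ortho (Tw := fun w => Twr w⁻¹) hL1 (by simpa using hTwr1) ?_ n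
    intro s w hw
    rw [← len_inv, ← len_inv w, inv_σ_mul] at hw
    rw [inv_σ_mul]
    exact hTwrrec s w⁻¹ hw
  let v (ξ : H L) (k j : ℕ) : H L :=
    ortho (p : ℂ) (L - 1) (∑ s, T s) k (ortho (p : ℂ) (L - 1) (∑ s, Tr s) j ξ)
  let c (k j : ℕ) : ℝ := sphereCoeff p m k * sphereCoeff p n j
  have expand_both (ξ : H L) (m n : ℕ) : hn m (hnr n ξ) = ∑ k ∈ Finset.range (m + 1),
      ∑ j ∈ Finset.range (n + 1), ((sphereCoeff p m k * sphereCoeff p n j : ℝ) : ℂ) • v ξ k j := by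
    rw [expand, expand_right, sum_apply]
    refine Finset.sum_congr rfl fun k _ => ?_
    rw [smul_apply, sum_apply, map_sum, Finset.smul_sum]
    refine Finset.sum_congr rfl fun j _ => ?_
    rw [smul_apply, map_smul, smul_smul, Complex.ofReal_mul]
  have hc : ∀ k j, m < k ∨ n < j → c k j = 0 := by
    rintro k j (h | h)
    · simp only [c, sphereCoeff_eq_zero p h, zero_mul]
    · simp only [c, sphereCoeff_eq_zero p h, mul_zero]
  have hb : ∀ k j, m < k ∨ n < j → altCoeff c m k j = 0 := fun _ _ => altCoeff_eq_zero hc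
  have hbc (k j : ℕ) : c k j = altCoeff c m k j + altCoeff c m (k + 1) (j + 1) :=
    (altCoeff_add_succ hc k j).symm
  have perp_left {ξ : H L} {l : ℕ} (hξ : ∀ y ∈ Sl L Q (∑ s, T s) (∑ s, Tr s) l, ⟪ξ, y⟫ = 0) :
      ∀ y ∈ V L (l - 1), ⟪ξ, Q l ((∑ s, T s) y)⟫ = 0 := fun y hy =>
    hξ _ (Submodule.subset_span (Or.inl ⟨y, hy, rfl⟩))
  have perp_right {ξ : H L} {l : ℕ} (hξ : ∀ y ∈ Sl L Q (∑ s, T s) (∑ s, Tr s) l, ⟪ξ, y⟫ = 0) :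
      ∀ y ∈ V L (l - 1), ⟪ξ, Q l ((∑ s, Tr s) y)⟫ = 0 := fun y hy =>
    hξ _ (Submodule.subset_span (Or.inr ⟨y, hy, rfl⟩))
  have hinv (x : List (Fin L)) :
      (cs L).wordProd x.reverse = Equiv.inv (W L) ((cs L).wordProd x) :=
    (cs L).wordProd_reverse x
  have repγ (k j : ℕ) : Rep (v γ k j) (middle (fun x => γ ((cs L).wordProd x)) l k j) := by
    refine rep_ortho_ortho hTl hTrr (middle_reverse _ l) (isRecursive_middle hl ?_)
      (isRecursive_middle hl ?_) (rep_middle hγmem) k j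
    · exact hTl.sum_cons_eq_zero (fun _ => rfl) hQ (perp_left hγperp)
    · simp only [hinv]
      exact hTrr.sum_cons_eq_zero len_inv hQ (perp_right hγperp)
  have repβ (k j : ℕ) : Rep (v β k j) (altMiddle (fun x => β ((cs L).wordProd x)) k j) := by
    refine rep_ortho_ortho hTl hTrr (altMiddle_reverse _) (isRecursive_altMiddle ?_)
      (isRecursive_altMiddle ?_) (rep_middle hβmem) k j
    · exact hTl.sum_singleton_eq_zero (fun _ => rfl) hQ (perp_left hβperp)
    · simp only [hinv]
      exact hTrr.sum_singleton_eq_zero len_inv hQ (perp_right hβperp)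
  have topγ (k j : ℕ) : Q (k + j + l) (hn k (hnr j γ)) = v γ k j := by
    refine Rep.ext ?_ (repγ k j)
    rw [expand_both]
    exact rep_projection hQ repγ (fun _ _ _ h => if_neg h.ne') (fun _ _ _ _ => rfl)
      (fun _ _ _ h => if_neg h) k j
  have topβ (k j : ℕ) : Rep (Q (k + j + 1) (hn k (hnr j β)))
      (middle (fun x => β ((cs L).wordProd x)) 1 k j) := by
    rw [expand_both]
    exact rep_projection hQ repβ (fun _ _ _ h => altMiddle_eq_zero _ h)
      (fun _ _ _ h => altMiddle_eq_middle _ h) (fun _ _ _ h => if_neg h) k j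
  refine ⟨altCoeff c m, c, hb, hc, ?_, ?_, fun k _ j _ => hbc k j⟩
  · rw [expand_both]
    refine sum_diagonal (v := v β) (E := fun k j => Q (k + j + 1) (hn k (hnr j β))) hb hbc
      (fun j => Rep.ext (topβ 0 j) (repβ 0 j)) (fun k => Rep.ext (topβ k 0) ?_)
      (fun k j => Rep.ext (topβ (k + 1) (j + 1)) ?_)
    · rw [← altMiddle_zero_right]
      exact repβ k 0
    · intro x hx
      have h1 := repβ (k + 1) (j + 1) x hx
      have h0 := repβ k j x hx
      rw [← coord_apply, map_add, coord_apply, coord_apply, h1, h0, altMiddle]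
      ring
  · simp only [topγ]
    exact expand_both γ m n

end UCoxMasa
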